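/- For every integer d ≥ 2, there exist an infinite set A ⊆ ℕ and a polynomial p ∈ ℚ[x] of degree d such that 0 < dim_FS(CE_{10}(A)) < dim_FS(CE_{10}(p(A))) < 1. -/

import Mathlib

/-- Number of sliding-block occurrences of `w` in `s`:
`N(w,s) = |{i : s[i…i+|w|−1] = w}|`. -/
def slideN {α : Type*} [DecidableEq α] (w s : List α) : ℕ :=
  ((Finset.range (s.length + 1 - w.length)).filter
    (fun i => ((s.drop i).take w.length) = w)).card

/-- Sliding count probability of `w` in `s`: `P(w,s) = N(w,s)/(|s|−|w|+1)`. -/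
noncomputable def slideP {α : Type*} [DecidableEq α] (w s : List α) : ℝ :=
  (slideN w s : ℝ) / ((s.length : ℝ) - (w.length : ℝ) + 1)

/-- `l`-th sliding block entropy of a string, with logarithms base `|α|`.
The convention `0 · log(1/0) = 0` holds automatically since `Real.logb b 0⁻¹ = 0`. -/
noncomputable def slideH {α : Type*} [Fintype α] [DecidableEq α] (l : ℕ) (x : List α) : ℝ :=
  (1 / (l : ℝ)) * ∑ w : Fin l → α,
    slideP (List.ofFn w) x * Real.logb (Fintype.card α) (slideP (List.ofFn w) x)⁻¹

/-- The prefix `S[0…n]` of a sequence, i.e. its first `n+1` symbols. -/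
def pre {α : Type*} (S : ℕ → α) (n : ℕ) : List α := List.ofFn (fun i : Fin (n + 1) => S i)

/-- Finite-state dimension via sliding block entropies:
`dim_FS(S) = inf_{l ≥ 1} liminf_{n→∞} H_l(S[0…n])`. -/
noncomputable def dimFS {α : Type*} [Fintype α] [DecidableEq α] (S : ℕ → α) : ℝ :=
  ⨅ l : ℕ, Filter.liminf (fun n => slideH (l + 1) (pre S n)) Filter.atTop

/-- Finite-state strong dimension:
`Dim_FS(S) = inf_{l ≥ 1} limsup_{n→∞} H_l(S[0…n])`. -/
noncomputable def DimFS {α : Type*} [Fintype α] [DecidableEq α] (S : ℕ → α) : ℝ :=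
  ⨅ l : ℕ, Filter.limsup (fun n => slideH (l + 1) (pre S n)) Filter.atTop
/-- Cumulative lengths of a sequence of lists. -/
def cumLen {α : Type*} (L : ℕ → List α) : ℕ → ℕ
  | 0 => 0
  | m + 1 => cumLen L m + (L m).length

open scoped Classical in
/-- The infinite sequence obtained by concatenating the lists `L 0, L 1, L 2, …`
(a default symbol is used in the degenerate case where the total length is finite). -/
noncomputable def concatSeq {α : Type*} (dflt : α) (L : ℕ → List α) (k : ℕ) : α :=
  if h : ∃ m, k < cumLen L (m + 1) then
    (L (Nat.find h)).getD (k - cumLen L (Nat.find h)) dflt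
  else dflt
/-- Big-endian base-`b` digit string of `n`, as symbols in `Σ_b = Fin b`. -/
def digitsFin (b : ℕ) (hb : 0 < b) (n : ℕ) : List (Fin b) :=
  (Nat.digits b n).reverse.map (fun d => ⟨d % b, Nat.mod_lt d hb⟩)

/-- The base-`b` Copeland–Erdős sequence `CE_b(A)` of an infinite set `A ⊆ ℕ`:
the concatenation of the base-`b` expansions of the elements of `A` in
increasing order (`Nat.nth (· ∈ A)` enumerates `A` in increasing order). -/
noncomputable def CEseq (b : ℕ) (hb : 0 < b) (A : Set ℕ) : ℕ → Fin b :=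
  concatSeq ⟨0, hb⟩ (fun i => digitsFin b hb (Nat.nth (· ∈ A) i))

/-- The base-`b` Copeland–Erdős sequence `CE_b(f(A))` for `f : ℕ → ℝ`:
the concatenation of the base-`b` expansions of the integer parts `⌊f(n)⌋`
for `n ∈ A` in increasing order of `n`. -/
noncomputable def CEseqF (b : ℕ) (hb : 0 < b) (A : Set ℕ) (f : ℕ → ℝ) : ℕ → Fin b :=
  concatSeq ⟨0, hb⟩ (fun i => digitsFin b hb ⌊f (Nat.nth (· ∈ A) i)⌋₊)

open Filter

section Entropy

variable {W : Type*} [Fintype W]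

lemma sum_mul_logb_inv_le (P : W → ℝ) (h0 : ∀ w, 0 ≤ P w) (h1 : ∑ w, P w = 1) (w₀ : W) :
    ∑ w, P w * Real.logb 10 (P w)⁻¹ ≤
      1 + (1 - P w₀) * Real.logb 10 (Fintype.card W) := by
  classical
  have hN : (0 : ℝ) < Fintype.card W := by
    exact_mod_cast Fintype.card_pos_iff.mpr ⟨w₀⟩
  set N : ℝ := (Fintype.card W : ℝ) with hNdef
  have hlog : 0 < Real.log 10 := Real.log_pos (by norm_num)
  set Q : W → ℝ := fun w => if w = w₀ then 1 / 2 else 1 / (2 * N) with hQ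
  have hQpos : ∀ w, 0 < Q w := by
    intro w; simp only [hQ]; split_ifs <;> positivity
  have hQle : ∀ w, Q w ≤ 1 / (2 * N) + (if w = w₀ then 1 / 2 else 0) := by
    intro w
    simp only [hQ]
    have : 0 ≤ 1 / (2 * N) := by positivity
    split_ifs <;> linarith
  have hQsum : ∑ w, Q w ≤ 1 := by
    calc ∑ w, Q w ≤ ∑ w, (1 / (2 * N) + (if w = w₀ then (1 : ℝ) / 2 else 0)) :=
          Finset.sum_le_sum fun w _ => hQle w
      _ = 1 := by
          rw [Finset.sum_add_distrib]
          simp only [Finset.sum_const, Finset.card_univ, nsmul_eq_mul, Finset.sum_ite_eq',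
            Finset.mem_univ, if_true]
          rw [← hNdef]; field_simp; norm_num
  have key : ∀ w, P w * Real.log (P w)⁻¹ ≤ P w * Real.log (Q w)⁻¹ + (Q w - P w) := by
    intro w
    rcases (h0 w).eq_or_lt with h | h
    · rw [← h]; simpa using (hQpos w).le
    · have := Real.log_le_sub_one_of_pos (div_pos (hQpos w) h)
      rw [Real.log_div (hQpos w).ne' h.ne'] at this
      have h2 := mul_le_mul_of_nonneg_left this h.le
      rw [mul_sub, mul_sub, mul_div_cancel₀ _ h.ne'] at h2
      rw [Real.log_inv, Real.log_inv]
      linarith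
  have hcross : ∀ w, P w * Real.log (Q w)⁻¹ ≤
      P w * (Real.log 2 + Real.log N) - (if w = w₀ then P w₀ * Real.log N else 0) := by
    intro w
    simp only [hQ]
    split_ifs with hw
    · subst hw
      rw [one_div, inv_inv]; linarith
    · rw [one_div, inv_inv, Real.log_mul two_ne_zero hN.ne']; linarith
  have hsum : ∑ w, P w * Real.log (P w)⁻¹ ≤ Real.log 2 + (1 - P w₀) * Real.log N := by
    calc ∑ w, P w * Real.log (P w)⁻¹
        ≤ ∑ w, ((P w * (Real.log 2 + Real.log N) -
            (if w = w₀ then P w₀ * Real.log N else 0)) + (Q w - P w)) :=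
          Finset.sum_le_sum fun w _ => (key w).trans (by linarith [hcross w])
      _ = (Real.log 2 + Real.log N) - P w₀ * Real.log N + (∑ w, Q w - 1) := by
          rw [Finset.sum_add_distrib, Finset.sum_sub_distrib, Finset.sum_sub_distrib,
            ← Finset.sum_mul, h1, Finset.sum_ite_eq' Finset.univ w₀]
          simp
      _ ≤ _ := by linarith
  have hl2 : Real.log 2 ≤ Real.log 10 := Real.log_le_log (by norm_num) (by norm_num)
  have e1 : ∑ w, P w * Real.logb 10 (P w)⁻¹ =
      (∑ w, P w * Real.log (P w)⁻¹) / Real.log 10 := by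
    rw [Finset.sum_div]
    exact Finset.sum_congr rfl fun w _ => by rw [Real.logb, mul_div_assoc]
  rw [e1, div_le_iff₀ hlog, Real.logb, add_mul, mul_assoc, div_mul_cancel₀ _ hlog.ne']
  linarith

lemma le_sum_mul_logb_inv [Nonempty W] (P : W → ℝ) (h1 : ∑ w, P w = 1) {c : ℝ}
    (hc0 : 0 ≤ c) (hc1 : c < 1) (hP : ∀ w, c / Fintype.card W ≤ P w) :
    c * Real.logb 10 (Fintype.card W) ≤ ∑ w, P w * Real.logb 10 (P w)⁻¹ := by
  have hN : (0 : ℝ) < Fintype.card W := by exact_mod_cast Fintype.card_pos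
  set N : ℝ := (Fintype.card W : ℝ) with hNdef
  have hlog : 0 < Real.log 10 := Real.log_pos (by norm_num)
  have hc1' : 0 < 1 - c := by linarith
  set Q : W → ℝ := fun w => (P w - c / N) / (1 - c) with hQ
  have hQ0 : ∀ w, 0 ≤ Q w := fun w => div_nonneg (by linarith [hP w]) hc1'.le
  have hQsum : ∑ w, Q w = 1 := by
    simp only [hQ]
    rw [← Finset.sum_div, Finset.sum_sub_distrib, h1]
    simp only [Finset.sum_const, Finset.card_univ, nsmul_eq_mul]
    rw [← hNdef]; field_simp
  have hQ1 : ∀ w, Q w ≤ 1 := fun w => hQsum ▸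
    Finset.single_le_sum (fun w _ => hQ0 w) (Finset.mem_univ w)
  have key : ∀ w, c * (N⁻¹ * Real.log N) ≤ P w * Real.log (P w)⁻¹ := by
    intro w
    have hconc := Real.concaveOn_negMulLog.2 (x := N⁻¹) (y := Q w)
      (by simp only [Set.mem_Ici]; positivity) (hQ0 w) hc0 hc1'.le (by ring)
    have e : c • N⁻¹ + (1 - c) • Q w = P w := by
      simp only [smul_eq_mul, hQ]; field_simp; ring
    rw [e] at hconc
    simp only [smul_eq_mul] at hconc
    have hq := mul_nonneg hc1'.le (Real.negMulLog_nonneg (hQ0 w) (hQ1 w))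
    have e2 : Real.negMulLog N⁻¹ = N⁻¹ * Real.log N := by
      rw [Real.negMulLog, Real.log_inv]; ring
    have e3 : Real.negMulLog (P w) = P w * Real.log (P w)⁻¹ := by
      rw [Real.negMulLog, Real.log_inv]; ring
    rw [e2, e3] at hconc
    linarith
  have e1 : ∑ w, P w * Real.logb 10 (P w)⁻¹ =
      (∑ w, P w * Real.log (P w)⁻¹) / Real.log 10 := by
    rw [Finset.sum_div]
    exact Finset.sum_congr rfl fun w _ => by rw [Real.logb, mul_div_assoc]
  rw [e1, le_div_iff₀ hlog, Real.logb, mul_assoc, div_mul_cancel₀ _ hlog.ne']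
  calc c * Real.log N = ∑ _w : W, c * (N⁻¹ * Real.log N) := by
        simp only [Finset.sum_const, Finset.card_univ, nsmul_eq_mul]
        rw [← hNdef]; field_simp
    _ ≤ _ := Finset.sum_le_sum fun w _ => key w

end Entropy

section Sliding

variable {α : Type*} [DecidableEq α]

lemma slideN_append {w : List α} (hw : w ≠ []) (x y : List α) :
    slideN w x + slideN w y ≤ slideN w (x ++ y) := by
  have hwl : 0 < w.length := List.length_pos_iff.mpr hw
  unfold slideN
  rw [← Finset.card_map (addRightEmbedding x.length)
    (s := (Finset.range (y.length + 1 - w.length)).filter _), ← Finset.card_union_of_disjoint]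
  · refine Finset.card_le_card ?_
    intro i hi
    simp only [Finset.mem_union, Finset.mem_filter, Finset.mem_range, Finset.mem_map,
      addRightEmbedding_apply, List.length_append] at hi ⊢
    rcases hi with ⟨h1, h2⟩ | ⟨j, ⟨h1, h2⟩, rfl⟩
    · refine ⟨by omega, ?_⟩
      rw [List.drop_append_of_le_length (by omega), List.take_append_of_le_length]
      · exact h2
      · rw [List.length_drop]; omega
    · refine ⟨by omega, ?_⟩
      rw [List.drop_append, List.drop_eq_nil_of_le (by omega)]
      simpa using h2
  · rw [Finset.disjoint_left]
    intro i hi hi'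
    simp only [Finset.mem_filter, Finset.mem_range, Finset.mem_map,
      addRightEmbedding_apply] at hi hi'
    obtain ⟨j, -, rfl⟩ := hi'
    omega

lemma slideN_le_append {w : List α} (hw : w ≠ []) (x y : List α) :
    slideN w x ≤ slideN w (x ++ y) :=
  (Nat.le_add_right _ _).trans (slideN_append hw x y)

lemma sum_slideN [Fintype α] {l : ℕ} (x : List α) :
    ∑ w : Fin l → α, slideN (List.ofFn w) x = x.length + 1 - l := by
  have h := Finset.card_eq_sum_card_fiberwise (s := Finset.range (x.length + 1 - l))
    (t := (Finset.univ : Finset (Fin l → α)).map ⟨List.ofFn, List.ofFn_injective⟩)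
    (f := fun i => (x.drop i).take l) (by
      intro i hi
      simp only [Finset.coe_range, Set.mem_Iio] at hi
      have hlen : ((x.drop i).take l).length = l := by
        rw [List.length_take, List.length_drop]; omega
      simp only [Finset.coe_map, Function.Embedding.coeFn_mk, Finset.coe_univ, Set.image_univ,
        Set.mem_range]
      refine ⟨fun k => ((x.drop i).take l)[k.1]'(by rw [hlen]; exact k.2), ?_⟩
      apply List.ext_getElem
      · rw [List.length_ofFn, hlen]
      · intro n h1 h2
        rw [List.getElem_ofFn])
  rw [Finset.sum_map, Finset.card_range] at h
  rw [h]
  unfold slideN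
  simp only [List.length_ofFn, Function.Embedding.coeFn_mk]

lemma slideP_eq {l : ℕ} (w : Fin l → α) (x : List α) :
    slideP (List.ofFn w) x = slideN (List.ofFn w) x / ((x.length : ℝ) - l + 1) := by
  rw [slideP, List.length_ofFn]

lemma slideP_nonneg {l : ℕ} {x : List α} (hl : l ≤ x.length) (w : Fin l → α) :
    0 ≤ slideP (List.ofFn w) x := by
  rw [slideP_eq]
  have : (l : ℝ) ≤ x.length := by exact_mod_cast hl
  exact div_nonneg (Nat.cast_nonneg _) (by linarith)

lemma sum_slideP [Fintype α] {l : ℕ} {x : List α} (hl : l ≤ x.length) :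
    ∑ w : Fin l → α, slideP (List.ofFn w) x = 1 := by
  simp only [slideP_eq]
  rw [← Finset.sum_div, ← Nat.cast_sum, sum_slideN, Nat.cast_sub (by omega)]
  have : (l : ℝ) ≤ x.length := by exact_mod_cast hl
  push_cast
  rw [div_eq_one_iff_eq (by linarith)]
  ring

end Sliding

section EntropyRate

variable {l : ℕ} {x : List (Fin 10)}

lemma logb_card_words (l : ℕ) : Real.logb 10 (Fintype.card (Fin l → Fin 10)) = l := by
  simp [Real.logb_pow]

lemma slideH_le (hl0 : 0 < l) (hl : l ≤ x.length) (w : Fin l → Fin 10) :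
    slideH l x ≤ 1 / l + (1 - slideP (List.ofFn w) x) := by
  have h := sum_mul_logb_inv_le (fun w : Fin l → Fin 10 => slideP (List.ofFn w) x)
    (slideP_nonneg hl) (sum_slideP hl) w
  rw [logb_card_words] at h
  have hl' : (0 : ℝ) < l := by exact_mod_cast hl0
  simp only [slideH, Fintype.card_fin, Nat.cast_ofNat]
  rw [one_div_mul_eq_div, div_le_iff₀ hl', add_mul, one_div_mul_cancel hl'.ne']
  exact h

lemma le_slideH (hl0 : 0 < l) (hl : l ≤ x.length) {c : ℝ} (hc0 : 0 ≤ c) (hc1 : c < 1)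
    (h : ∀ w : Fin l → Fin 10, c / 10 ^ l ≤ slideP (List.ofFn w) x) : c ≤ slideH l x := by
  have h := le_sum_mul_logb_inv (fun w : Fin l → Fin 10 => slideP (List.ofFn w) x)
    (sum_slideP hl) hc0 hc1 (by simpa using h)
  rw [logb_card_words] at h
  have hl' : (0 : ℝ) < l := by exact_mod_cast hl0
  simp only [slideH, Fintype.card_fin, Nat.cast_ofNat]
  rwa [one_div_mul_eq_div, le_div_iff₀ hl']

lemma slideH_nonneg (hl0 : 0 < l) (hl : l ≤ x.length) : 0 ≤ slideH l x :=
  le_slideH hl0 hl le_rfl one_pos fun w => by simpa using slideP_nonneg hl w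

end EntropyRate

section Dimension

variable {S : ℕ → Fin 10}

lemma length_pre {α : Type*} (S : ℕ → α) (n : ℕ) : (pre S n).length = n + 1 := by simp [pre]

lemma eventually_length_pre (S : ℕ → Fin 10) (l : ℕ) : ∀ᶠ n in atTop, l ≤ (pre S n).length := by
  filter_upwards [eventually_ge_atTop l] with n hn
  rw [length_pre]; omega

lemma eventually_slideH_nonneg (S : ℕ → Fin 10) (l : ℕ) :
    ∀ᶠ n in atTop, 0 ≤ slideH (l + 1) (pre S n) := by
  filter_upwards [eventually_length_pre S (l + 1)] with n hn
  exact slideH_nonneg l.succ_pos hn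

lemma eventually_slideH_le (S : ℕ → Fin 10) (l : ℕ) :
    ∀ᶠ n in atTop, slideH (l + 1) (pre S n) ≤ 2 := by
  filter_upwards [eventually_length_pre S (l + 1)] with n hn
  have h := slideH_le l.succ_pos hn (fun _ => 0)
  have h1 := slideP_nonneg hn (fun _ => 0)
  have h2 : (1 : ℝ) / ((l + 1 : ℕ) : ℝ) ≤ 1 := by
    rw [div_le_one (by positivity)]; simp
  linarith

lemma le_liminf_slideH {l : ℕ} {c : ℝ}
    (h : ∀ᶠ n in atTop, c ≤ slideH (l + 1) (pre S n)) :
    c ≤ liminf (fun n => slideH (l + 1) (pre S n)) atTop :=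
  le_liminf_of_le (IsBoundedUnder.isCoboundedUnder_ge ⟨2, eventually_slideH_le S l⟩) h

lemma le_dimFS {c : ℝ} (h : ∀ l, ∀ᶠ n in atTop, c ≤ slideH (l + 1) (pre S n)) :
    c ≤ dimFS S :=
  le_ciInf fun l => le_liminf_slideH (h l)

lemma dimFS_le {l : ℕ} {c : ℝ} (h : ∃ᶠ n in atTop, slideH (l + 1) (pre S n) ≤ c) :
    dimFS S ≤ c := by
  refine (ciInf_le ⟨0, ?_⟩ l).trans
    (liminf_le_of_frequently_le h ⟨0, eventually_slideH_nonneg S l⟩)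
  rintro _ ⟨k, rfl⟩
  exact le_liminf_slideH (eventually_slideH_nonneg S k)

end Dimension

section Concatenation

variable {α : Type*} {L : ℕ → List α}

lemma cumLen_mono (L : ℕ → List α) : Monotone (cumLen L) :=
  monotone_nat_of_le_succ fun m => by simp [cumLen]

lemma le_cumLen (hL : ∀ m, 0 < (L m).length) (m : ℕ) : m ≤ cumLen L m := by
  induction m with
  | zero => exact Nat.zero_le _
  | succ m ih => have := hL m; simp only [cumLen]; omega

lemma concatSeq_cumLen_add (dflt : α) {m i : ℕ} (hi : i < (L m).length) :
    concatSeq dflt L (cumLen L m + i) = (L m)[i] := by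
  classical
  have h : ∃ k, cumLen L m + i < cumLen L (k + 1) := ⟨m, by simp only [cumLen]; omega⟩
  have hfind : Nat.find h = m := by
    refine (Nat.find_eq_iff h).mpr ⟨by simp only [cumLen]; omega, fun n hn => ?_⟩
    have := cumLen_mono L (show n + 1 ≤ m from hn)
    omega
  have hd : concatSeq dflt L (cumLen L m + i) =
      (L (Nat.find h)).getD (cumLen L m + i - cumLen L (Nat.find h)) dflt := by
    rw [concatSeq, dif_pos h]
  rw [hd, hfind, Nat.add_sub_cancel_left, List.getD_eq_getElem _ _ hi]

lemma ofFn_add (S : ℕ → α) (a b : ℕ) :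
    List.ofFn (fun i : Fin (a + b) => S i) =
      List.ofFn (fun i : Fin a => S i) ++ List.ofFn (fun i : Fin b => S (a + i)) := by
  rw [List.ofFn_add]; simp

lemma ofFn_concatSeq_succ (dflt : α) (L : ℕ → List α) (m : ℕ) :
    List.ofFn (fun i : Fin (cumLen L (m + 1)) => concatSeq dflt L i) =
      List.ofFn (fun i : Fin (cumLen L m) => concatSeq dflt L i) ++ L m := by
  have h := ofFn_add (concatSeq dflt L) (cumLen L m) (L m).length
  rw [show List.ofFn (fun i : Fin (L m).length => concatSeq dflt L (cumLen L m + i)) = L m from ?_]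
    at h
  · exact h
  · apply List.ext_getElem
    · simp
    · intro i h1 h2
      rw [List.getElem_ofFn, concatSeq_cumLen_add dflt h2]

lemma sum_slideN_le_slideN_ofFn [DecidableEq α] {w : List α} (hw : w ≠ []) (dflt : α) (L : ℕ → List α) (m : ℕ) :
    ∑ k ∈ Finset.range m, slideN w (L k) ≤
      slideN w (List.ofFn (fun i : Fin (cumLen L m) => concatSeq dflt L i)) := by
  induction m with
  | zero => simp
  | succ m ih =>
    rw [Finset.sum_range_succ, ofFn_concatSeq_succ]
    exact (Nat.add_le_add_right ih _).trans (slideN_append hw _ _)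

lemma sum_slideN_le_slideN_pre [DecidableEq α] {w : List α} (hw : w ≠ []) (dflt : α) (L : ℕ → List α) {m n : ℕ}
    (h : cumLen L m ≤ n + 1) :
    ∑ k ∈ Finset.range m, slideN w (L k) ≤ slideN w (pre (concatSeq dflt L) n) := by
  refine (sum_slideN_le_slideN_ofFn hw dflt L m).trans ?_
  obtain ⟨b, hb⟩ := Nat.exists_eq_add_of_le h
  have e : pre (concatSeq dflt L) n =
      List.ofFn (fun i : Fin (cumLen L m + b) => concatSeq dflt L i) := by
    unfold pre; rw [hb]
  rw [e, ofFn_add]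
  exact slideN_le_append hw _ _

lemma exists_cumLen_le (hL : ∀ m, 0 < (L m).length) (n : ℕ) :
    ∃ m, cumLen L m ≤ n ∧ n < cumLen L (m + 1) := by
  classical
  have h : ∃ m, n < cumLen L (m + 1) := ⟨n, le_cumLen hL (n + 1)⟩
  refine ⟨Nat.find h, ?_, Nat.find_spec h⟩
  rcases hm : Nat.find h with _ | k
  · exact Nat.zero_le _
  · have := Nat.find_min h (m := k) (by omega)
    omega

end Concatenation

section Bounds

variable {L : ℕ → List (Fin 10)}

lemma cumLen_le {B : ℕ} (hB : ∀ t, (L t).length ≤ B * (t + 1) * 10 ^ t) (t : ℕ) :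
    cumLen L (t + 1) ≤ 2 * B * (t + 1) * 10 ^ t := by
  induction t with
  | zero => have := hB 0; simp only [cumLen] at *; omega
  | succ t ih =>
    have h := hB (t + 1)
    rw [cumLen]
    have e : 2 * B * (t + 1) * 10 ^ t ≤ B * (t + 1 + 1) * 10 ^ (t + 1) := by
      rw [pow_succ]
      calc 2 * B * (t + 1) * 10 ^ t ≤ 10 * B * (t + 1 + 1) * 10 ^ t := by gcongr <;> omega
        _ = _ := by ring
    calc _ ≤ _ := Nat.add_le_add (ih.trans e) h
      _ = _ := by ring

lemma dimFS_concatSeq_ge {e B : ℕ} (hB0 : 0 < B) (hL : ∀ m, 0 < (L m).length)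
    (hB : ∀ t, (L t).length ≤ B * (t + 1) * 10 ^ t)
    (hN : ∀ (l : ℕ) (w : Fin l → Fin 10) (t : ℕ), 0 < l → e + l < t →
      (t - e - l) * (10 ^ (t - e - l) - 1) ≤ slideN (List.ofFn w) (L t))
    (dflt : Fin 10) :
    (10 ^ (e + 3) * B : ℝ)⁻¹ ≤ dimFS (concatSeq dflt L) := by
  have hBpos : (1 : ℝ) ≤ B := by exact_mod_cast hB0
  have hden : (1 : ℝ) < 10 ^ (e + 3) * B := by
    have : (1 : ℝ) < 10 ^ (e + 3) := one_lt_pow₀ (by norm_num) (by omega)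
    nlinarith
  suffices key : ∀ l, 0 < l → ∀ᶠ n in atTop,
      (10 ^ (e + 3) * B : ℝ)⁻¹ ≤ slideH l (pre (concatSeq dflt L) n) from
    le_dimFS fun l => key (l + 1) l.succ_pos
  intro l hl
  filter_upwards [eventually_ge_atTop (cumLen L (2 * (e + l) + 4)),
    eventually_length_pre (concatSeq dflt L) l] with n hn hlen
  refine le_slideH hl hlen (by positivity) (inv_lt_one_of_one_lt₀ hden) fun w => ?_
  obtain ⟨m, hm1, hm2⟩ := exists_cumLen_le hL n
  have hm : 2 * (e + l) + 4 ≤ m := by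
    by_contra! hlt
    have := cumLen_mono L (show m + 1 ≤ 2 * (e + l) + 4 by omega)
    omega
  obtain ⟨u, rfl⟩ : ∃ u, m = e + l + u + 1 := ⟨m - (e + l) - 1, by omega⟩
  have hu : e + l + 3 ≤ u := by omega
  have hw : List.ofFn w ≠ [] := by simp [hl.ne']
  have hcount : u * (10 ^ u - 1) ≤ slideN (List.ofFn w) (pre (concatSeq dflt L) n) := by
    have h1 := hN l w (e + l + u) hl (by omega)
    rw [show e + l + u - e - l = u by omega] at h1
    refine h1.trans (le_trans ?_ (sum_slideN_le_slideN_pre hw dflt L (hm1.trans n.le_succ)))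
    exact Finset.single_le_sum (f := fun k => slideN (List.ofFn w) (L k))
      (fun _ _ => Nat.zero_le _) (by simp)
  have hlen2 : n + 1 ≤ 2 * B * (2 * u) * 10 ^ (e + l + u + 1) := by
    calc n + 1 ≤ _ := hm2
      _ ≤ _ := cumLen_le hB _
      _ ≤ _ := by gcongr; omega
  have hcountR : (u : ℝ) * (10 ^ u / 2) ≤ slideN (List.ofFn w) (pre (concatSeq dflt L) n) := by
    have h10 : 2 ≤ 10 ^ u := le_trans (by norm_num) (Nat.pow_le_pow_right (by norm_num)
      (show 1 ≤ u by omega))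
    have h10' : (2 : ℝ) ≤ 10 ^ u := by exact_mod_cast h10
    have : ((u * (10 ^ u - 1) : ℕ) : ℝ) ≤ slideN (List.ofFn w) (pre (concatSeq dflt L) n) := by
      exact_mod_cast hcount
    refine le_trans ?_ this
    rw [Nat.cast_mul, Nat.cast_sub (by omega)]
    push_cast
    gcongr
    linarith
  have hlenR : ((n : ℝ) + 1) ≤ 2 * B * (2 * u) * 10 ^ (e + l + u + 1) := by exact_mod_cast hlen2
  rw [slideP_eq, length_pre] at *
  have hln : (l : ℝ) ≤ ((n + 1 : ℕ) : ℝ) := by exact_mod_cast hlen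
  have hl1 : (1 : ℝ) ≤ l := by exact_mod_cast hl
  push_cast at hln ⊢
  rw [div_le_div_iff₀ (by positivity) (by linarith), inv_mul_le_iff₀ (by positivity)]
  calc ((n : ℝ) + 1 - l + 1) ≤ n + 1 := by linarith
    _ ≤ 2 * B * (2 * u) * 10 ^ (e + l + u + 1) := hlenR
    _ ≤ 10 ^ (e + 3) * B * (u * (10 ^ u / 2) * 10 ^ l) := by
        have : (0 : ℝ) ≤ 10 ^ e * 10 ^ l * 10 ^ u * B * u := by positivity
        rw [pow_add _ e 3, pow_add _ (e + l + u), pow_add _ (e + l), pow_add _ e l]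
        nlinarith
    _ ≤ _ := by gcongr

lemma dimFS_concatSeq_le {l : ℕ} {a : ℝ} (ha : 0 ≤ a) (hL : ∀ m, 0 < (L m).length) (dflt : Fin 10)
    (w : Fin (l + 1) → Fin 10)
    (h : ∀ᶠ t in atTop, a * cumLen L (t + 1) ≤
      ((∑ k ∈ Finset.range (t + 1), slideN (List.ofFn w) (L k) : ℕ) : ℝ)) :
    dimFS (concatSeq dflt L) ≤ 1 / ((l : ℝ) + 1) + (1 - a) := by
  apply dimFS_le (l := l)
  have htend : Tendsto (fun t => cumLen L (t + 1) - 1) atTop atTop := by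
    refine tendsto_atTop_mono (fun t => ?_) tendsto_id
    have := le_cumLen hL (t + 1)
    simp only [id]; omega
  refine htend.frequently (Eventually.frequently ?_)
  filter_upwards [h, htend.eventually (eventually_length_pre (concatSeq dflt L) (l + 1))]
    with t ht hlen
  have hpos := le_cumLen hL (t + 1)
  set n := cumLen L (t + 1) - 1 with hn
  have hcum : cumLen L (t + 1) = n + 1 := by omega
  have hH := slideH_le l.succ_pos hlen w
  have hw : List.ofFn w ≠ [] := by simp
  have hcount := sum_slideN_le_slideN_pre hw dflt L hcum.le
  have hcountR : ((∑ k ∈ Finset.range (t + 1), slideN (List.ofFn w) (L k) : ℕ) : ℝ) ≤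
    slideN (List.ofFn w) (pre (concatSeq dflt L) n) := by exact_mod_cast hcount
  have hP : a ≤ slideP (List.ofFn w) (pre (concatSeq dflt L) n) := by
    rw [length_pre] at hlen
    have hln : ((l + 1 : ℕ) : ℝ) ≤ ((n + 1 : ℕ) : ℝ) := by exact_mod_cast hlen
    rw [slideP_eq, length_pre, le_div_iff₀ (by linarith)]
    refine le_trans ?_ (ht.trans hcountR)
    rw [hcum]
    gcongr
    push_cast
    linarith [(Nat.cast_nonneg l : (0 : ℝ) ≤ l)]
  push_cast at hH
  linarith

end Bounds

section Digits

lemma length_digitsFin (hb : 0 < 10) (n : ℕ) :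
    (digitsFin 10 hb n).length = (Nat.digits 10 n).length := by simp [digitsFin]

lemma lt_length_digits_iff {k n : ℕ} : k < (Nat.digits 10 n).length ↔ 10 ^ k ≤ n :=
  Nat.lt_digits_length_iff (by norm_num) n

lemma digits_length_le {k n : ℕ} (h : n < 10 ^ k) : (Nat.digits 10 n).length ≤ k := by
  by_contra! h'
  exact absurd (lt_length_digits_iff.mp h') (by omega)

/-- The value of a word read as a big-endian decimal numeral. -/
def wordVal {l : ℕ} (w : Fin l → Fin 10) : ℕ := ∑ k : Fin l, (w k : ℕ) * 10 ^ (l - 1 - k)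

lemma wordVal_succ {l : ℕ} (w : Fin (l + 1) → Fin 10) :
    wordVal w = 10 * wordVal (fun k => w k.castSucc) + w (Fin.last l) := by
  unfold wordVal
  rw [Fin.sum_univ_castSucc, Finset.mul_sum]
  congr 1
  · refine Finset.sum_congr rfl fun k _ => ?_
    have := k.2
    rw [Fin.val_castSucc, show l + 1 - 1 - (k : ℕ) = (l - 1 - k) + 1 by omega, pow_succ]
    ring
  · simp

lemma wordVal_lt {l : ℕ} (w : Fin l → Fin 10) : wordVal w < 10 ^ l := by
  induction l with
  | zero => simp [wordVal]
  | succ l ih =>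
    have h1 := ih (fun k => w k.castSucc)
    have h2 := (w (Fin.last l)).2
    rw [wordVal_succ, pow_succ]
    omega

lemma wordVal_div_mod {l : ℕ} (w : Fin l → Fin 10) (k : Fin l) :
    wordVal w / 10 ^ (l - 1 - k) % 10 = w k := by
  induction l with
  | zero => exact k.elim0
  | succ l ih =>
    rw [wordVal_succ]
    have h2 := (w (Fin.last l)).2
    refine Fin.lastCases ?_ (fun j => ?_) k
    · simp only [Fin.val_last, Nat.add_sub_cancel, Nat.sub_self, pow_zero, Nat.div_one]
      omega
    · have := ih (fun k => w k.castSucc) j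
      have hj := j.2
      rw [Fin.val_castSucc, show l + 1 - 1 - (j : ℕ) = (l - 1 - j) + 1 by omega, pow_succ',
        ← Nat.div_div_eq_div_mul, ← this]
      congr 2
      omega

lemma digitsFin_getElem (hb : 0 < 10) {V i : ℕ} (hi : i < (digitsFin 10 hb V).length) :
    (((digitsFin 10 hb V)[i] : Fin 10) : ℕ) =
      V / 10 ^ ((Nat.digits 10 V).length - 1 - i) % 10 := by
  have hi' : i < (Nat.digits 10 V).length := by rwa [length_digitsFin] at hi
  simp only [digitsFin, List.getElem_map, List.getElem_reverse]
  rw [Nat.mod_eq_of_lt (Nat.digits_lt_base (by norm_num) (List.getElem_mem _)),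
    ← Nat.getD_digits V _ (by norm_num : 2 ≤ 10), List.getD_eq_getElem]

lemma card_le_slideN_digitsFin (hb : 0 < 10) {l V K : ℕ} (hV : 10 ^ K ≤ V) (w : Fin l → Fin 10)
    (F : Finset ℕ) (hF : ∀ s ∈ F, s + l ≤ K ∧ V / 10 ^ s % 10 ^ l = wordVal w) :
    F.card ≤ slideN (List.ofFn w) (digitsFin 10 hb V) := by
  have hK : K < (digitsFin 10 hb V).length := by
    rw [length_digitsFin]; exact lt_length_digits_iff.mpr hV
  set N := (digitsFin 10 hb V).length with hN
  have hN' : (Nat.digits 10 V).length = N := (length_digitsFin hb V).symm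
  unfold slideN
  refine Finset.card_le_card_of_injOn (fun s => N - l - s) (fun s hs => ?_) ?_
  · obtain ⟨h1, h2⟩ := hF s hs
    simp only [List.length_ofFn, Finset.coe_filter, Finset.mem_range, Set.mem_ofPred_eq]
    refine ⟨by omega, ?_⟩
    apply List.ext_getElem
    · simp only [List.length_take, List.length_drop, List.length_ofFn]; omega
    · intro k hk1 hk2
      rw [List.length_ofFn] at hk2
      rw [List.getElem_take, List.getElem_drop, List.getElem_ofFn]
      apply Fin.ext
      rw [digitsFin_getElem, hN', ← wordVal_div_mod w ⟨k, hk2⟩, ← h2,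
        show N - 1 - (N - l - s + k) = s + (l - 1 - k) by omega]
      simp only
      obtain ⟨r, hr⟩ : ∃ r, l = (l - 1 - k) + 1 + r := ⟨k, by omega⟩
      generalize l - 1 - k = q at hr
      rw [hr, pow_add 10 s, ← Nat.div_div_eq_div_mul, add_assoc, pow_add,
        Nat.mod_mul_right_div_self, pow_add, pow_one, Nat.mod_mul_right_mod]
  · intro s hs s' hs' h
    have := (hF s hs).1
    have := (hF s' hs').1
    simp only at h
    omega

end Digits

section Blocks

lemma exists_block_split (X J : ℕ) (Z : ℕ) (c : ℕ → ℕ) {j : ℕ} (hj : j < J) :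
    ∃ Y, ∑ k ∈ Finset.range J, c k * X ^ k + X ^ J * Z =
      ∑ k ∈ Finset.range j, c k * X ^ k + X ^ j * (c j + X * Y) := by
  induction J, hj using Nat.le_induction generalizing Z with
  | base => exact ⟨Z, by rw [Nat.succ_eq_add_one, Finset.sum_range_succ, pow_succ]; ring⟩
  | succ J hJ ih =>
    obtain ⟨Y, hY⟩ := ih (c J + X * Z)
    refine ⟨Y, ?_⟩
    rw [← hY, Finset.sum_range_succ]
    ring

lemma sum_block_lt {X : ℕ} (c : ℕ → ℕ) (J : ℕ) (hc : ∀ j < J, c j < X) :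
    ∑ k ∈ Finset.range J, c k * X ^ k < X ^ J := by
  induction J with
  | zero => simp
  | succ J ih =>
    have h1 := ih fun j hj => hc j (by omega)
    have h2 : (c J + 1) * X ^ J ≤ X * X ^ J := Nat.mul_le_mul_right _ (hc J (by omega))
    rw [Finset.sum_range_succ, pow_succ']
    linarith

lemma block_window {m J l T low Z : ℕ} {c : ℕ → ℕ} (hc : ∀ j < J, c j < 10 ^ m)
    (hlow : low < 10 ^ T) {i j : ℕ} (hj : j < J) (hi : i + l ≤ m) :
    (10 ^ T * (∑ k ∈ Finset.range J, c k * (10 ^ m) ^ k + (10 ^ m) ^ J * Z) + low) /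
      10 ^ (T + (m * j + i)) % 10 ^ l = c j / 10 ^ i % 10 ^ l := by
  obtain ⟨Y, hY⟩ := exists_block_split (10 ^ m) J Z c hj
  have hlt := sum_block_lt c j fun k hk => hc k (by omega)
  rw [hY, pow_add, ← Nat.div_div_eq_div_mul, Nat.mul_add_div (by positivity),
    Nat.div_eq_of_lt hlow, add_zero, pow_add, ← Nat.div_div_eq_div_mul, pow_mul,
    Nat.add_mul_div_left _ _ (by positivity), Nat.div_eq_of_lt hlt, zero_add]
  obtain ⟨r, rfl⟩ := Nat.exists_eq_add_of_le hi
  rw [← Nat.mod_mul_right_div_self, ← Nat.mod_mul_right_div_self (c j), ← pow_add, pow_add _ _ r,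
    mul_assoc, Nat.add_mul_mod_self_left]

lemma card_le_slideN_of_blocks (hb : 0 < 10) {m J l T low Z V : ℕ} {c : ℕ → ℕ} (hl : 0 < l)
    (hc : ∀ j < J, c j < 10 ^ m) (hlow : low < 10 ^ T)
    (hV : V = 10 ^ T * (∑ k ∈ Finset.range J, c k * (10 ^ m) ^ k + (10 ^ m) ^ J * Z) + low)
    (hZ : 10 ^ (T + m * J) ≤ V) (w : Fin l → Fin 10) (G : Finset (ℕ × ℕ))
    (hG : ∀ q ∈ G, q.1 < J ∧ q.2 + l ≤ m ∧ c q.1 / 10 ^ q.2 % 10 ^ l = wordVal w) :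
    G.card ≤ slideN (List.ofFn w) (digitsFin 10 hb V) := by
  rw [← Finset.card_image_of_injOn (f := fun q : ℕ × ℕ => T + (m * q.1 + q.2)) (s := G)]
  · refine card_le_slideN_digitsFin hb hZ w _ fun s hs => ?_
    obtain ⟨q, hq, rfl⟩ := Finset.mem_image.mp hs
    obtain ⟨h1, h2, h3⟩ := hG q hq
    refine ⟨?_, ?_⟩
    · have : m * (q.1 + 1) ≤ m * J := Nat.mul_le_mul_left _ h1
      rw [mul_add] at this
      omega
    · rw [hV, block_window hc hlow h1 h2, h3]
  · rintro ⟨j, i⟩ hq ⟨j', i'⟩ hq' h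
    obtain ⟨-, h2, -⟩ := hG _ hq
    obtain ⟨-, h2', -⟩ := hG _ hq'
    simp only at h h2 h2'
    have hm : 0 < m := by omega
    have e : m * j + i = m * j' + i' := by omega
    have ej : j = j' := by
      have := congrArg (· / m) e
      simpa [Nat.mul_add_div hm, Nat.div_eq_of_lt (show i < m by omega),
        Nat.div_eq_of_lt (show i' < m by omega)] using this
    subst ej
    simp only [Prod.mk.injEq, true_and]
    omega

end Blocks

section Ascending

/-- The base-`X` repunit with `J` digits. -/
def repunit (X J : ℕ) : ℕ := ∑ k ∈ Finset.range J, X ^ k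

/-- The number whose base-`X` blocks, from low to high, are `1, 2, …, J`. -/
def ascending (X J : ℕ) : ℕ := ∑ k ∈ Finset.range J, (k + 1) * X ^ k

lemma repunit_succ (X J : ℕ) : repunit X (J + 1) = repunit X J + X ^ J := by
  rw [repunit, Finset.sum_range_succ, repunit]

lemma repunit_succ' (X J : ℕ) : repunit X (J + 1) = 1 + X * repunit X J := by
  rw [repunit, Finset.sum_range_succ', repunit, Finset.mul_sum, add_comm]
  simp [pow_succ']

lemma ascending_succ (X J : ℕ) : ascending X (J + 1) = repunit X (J + 1) + X * ascending X J := by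
  induction J with
  | zero => simp [ascending, repunit]
  | succ J ih =>
    have hs : ∀ J, ascending X (J + 1) = ascending X J + (J + 1) * X ^ J := fun J => by
      rw [ascending, Finset.sum_range_succ, ← ascending]
    nth_rewrite 1 [hs (J + 1), ih]
    rw [hs J, repunit_succ X (J + 1), pow_succ]
    ring

lemma repunit_sq (X J : ℕ) : ∃ Z, repunit X J ^ 2 = ascending X J + X ^ J * Z := by
  induction J with
  | zero => exact ⟨0, by simp [repunit, ascending]⟩
  | succ J ih =>
    obtain ⟨Z, hZ⟩ := ih
    refine ⟨Z + repunit X J, ?_⟩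
    calc repunit X (J + 1) ^ 2 = repunit X (J + 1) * (1 + X * repunit X J) := by
          rw [← repunit_succ', sq]
      _ = repunit X (J + 1) + X * (repunit X J ^ 2 + repunit X J * X ^ J) := by
          rw [repunit_succ X J]; ring
      _ = _ := by rw [hZ, ascending_succ]; ring

lemma le_card_window {m l i v : ℕ} (hi : i + l ≤ m) (hv : v < 10 ^ l) :
    10 ^ (m - l) - 1 ≤
      ((Finset.range (10 ^ m - 1)).filter fun j => (j + 1) / 10 ^ i % 10 ^ l = v).card := by
  obtain ⟨r, rfl⟩ := Nat.exists_eq_add_of_le hi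
  have h1 : 10 ^ r * 10 ^ i ≤
      ((Finset.range (10 ^ (i + l + r))).filter fun j => j / 10 ^ i % 10 ^ l = v).card := by
    have hp : (Finset.range (10 ^ r) ×ˢ Finset.range (10 ^ i)).card = 10 ^ r * 10 ^ i := by simp
    rw [← hp]
    refine Finset.card_le_card_of_injOn (fun q => (q.1 * 10 ^ l + v) * 10 ^ i + q.2) ?_ ?_
    · rintro ⟨a, b⟩ hq
      simp only [Finset.coe_product, Finset.coe_range, Set.mem_prod, Set.mem_Iio] at hq
      simp only [Finset.coe_filter, Finset.mem_range, Set.mem_ofPred_eq]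
      constructor
      · have e1 : (a + 1) * 10 ^ l ≤ 10 ^ r * 10 ^ l := Nat.mul_le_mul_right _ hq.1
        have e2 : a * 10 ^ l + v + 1 ≤ 10 ^ r * 10 ^ l := by linarith
        have e3 := Nat.mul_le_mul_right (10 ^ i) e2
        rw [pow_add, pow_add]
        calc (a * 10 ^ l + v) * 10 ^ i + b < (a * 10 ^ l + v + 1) * 10 ^ i := by linarith
          _ ≤ _ := e3
          _ = _ := by ring
      · rw [mul_comm _ (10 ^ i), Nat.mul_add_div (by positivity), Nat.div_eq_of_lt hq.2, add_zero,
          mul_comm, Nat.mul_add_mod, Nat.mod_eq_of_lt hv]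
    · rintro ⟨a, b⟩ hq ⟨a', b'⟩ hq' h
      simp only [Finset.coe_product, Finset.coe_range, Set.mem_prod, Set.mem_Iio] at hq hq'
      simp only at h
      have hd := congrArg (· / 10 ^ i) h
      simp only [mul_comm _ (10 ^ i), Nat.mul_add_div (pow_pos (show 0 < 10 by norm_num) i),
        Nat.div_eq_of_lt hq.2, Nat.div_eq_of_lt hq'.2, add_zero] at hd
      have ha : a = a' := Nat.eq_of_mul_eq_mul_right (pow_pos (show 0 < 10 by norm_num) l)
        (Nat.add_right_cancel hd)
      subst ha
      simpa using h
  have h2 : ((Finset.range (10 ^ (i + l + r))).filter fun j => j / 10 ^ i % 10 ^ l = v) ⊆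
      insert 0 (((Finset.range (10 ^ (i + l + r) - 1)).filter
        fun j => (j + 1) / 10 ^ i % 10 ^ l = v).image (· + 1)) := by
    intro j hj
    simp only [Finset.mem_filter, Finset.mem_range, Finset.mem_insert, Finset.mem_image] at hj ⊢
    rcases j with _ | j
    · exact Or.inl rfl
    · exact Or.inr ⟨j, ⟨by omega, hj.2⟩, rfl⟩
  have h3 := (Finset.card_le_card h2).trans (Finset.card_insert_le _ _)
  have h4 := h3.trans (Nat.add_le_add_right Finset.card_image_le 1)
  rw [show i + l + r - l = r + i by omega, pow_add]
  omega

lemma le_slideN_of_ascending (hb : 0 < 10) {m l T low Z V : ℕ} (hl : 0 < l) (hlow : low < 10 ^ T)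
    (hV : V = 10 ^ T * (ascending (10 ^ m) (10 ^ m - 1) + (10 ^ m) ^ (10 ^ m - 1) * Z) + low)
    (hZ : 10 ^ (T + m * (10 ^ m - 1)) ≤ V) (w : Fin l → Fin 10) :
    (m - l) * (10 ^ (m - l) - 1) ≤ slideN (List.ofFn w) (digitsFin 10 hb V) := by
  rcases Nat.lt_or_ge m l with hml | hml
  · rw [Nat.sub_eq_zero_of_le hml.le, zero_mul]; exact Nat.zero_le _
  refine le_trans ?_ (card_le_slideN_of_blocks hb (c := fun k => k + 1) hl
    (fun j hj => by omega) hlow hV hZ w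
    ((Finset.range (10 ^ m - 1) ×ˢ Finset.range (m - l)).filter
      fun q => (q.1 + 1) / 10 ^ q.2 % 10 ^ l = wordVal w) ?_)
  · rw [Finset.card_filter, Finset.sum_product_right]
    refine le_trans (le_of_eq ?_) (Finset.card_nsmul_le_sum (Finset.range (m - l)) _
      (10 ^ (m - l) - 1) fun i hi => ?_)
    · simp
    · rw [Finset.mem_range] at hi
      rw [← Finset.card_filter]
      exact le_card_window (by omega) (wordVal_lt w)
  · rintro ⟨j, i⟩ hq
    simp only [Finset.mem_filter, Finset.mem_product, Finset.mem_range] at hq ⊢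
    exact ⟨hq.1.1, by omega, hq.2⟩

end Ascending

section Construction

/-- The number of digits occupied by the `10 ^ m - 1` blocks of length `m`. -/
def blockLen (m : ℕ) : ℕ := m * (10 ^ m - 1)

/-- A numeral whose digits list all nonzero `m`-digit blocks, preceded by a digit `1`. -/
def universalNum (m : ℕ) : ℕ := ascending (10 ^ m) (10 ^ m - 1) + 10 ^ blockLen m

/-- A universal numeral of order `m - e`, followed by a repunit in base `10 ^ m` and zeros. -/
def sparseNum (e m : ℕ) : ℕ :=
  10 ^ blockLen m *
    (repunit (10 ^ m) (10 ^ m - 1) + 10 ^ blockLen m * universalNum (m - e))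

/-- The value `n ^ 2 + n ^ d`, with the second summand dropped when `d = 2`. -/
def powerSum (d n : ℕ) : ℕ := n ^ 2 + if d = 2 then 0 else n ^ d

lemma pow_blockLen (m : ℕ) : (10 ^ m) ^ (10 ^ m - 1) = 10 ^ blockLen m := by
  rw [blockLen, pow_mul]

lemma blockLen_lt_succ (m : ℕ) : blockLen m < blockLen (m + 1) := by
  have h : 10 ^ m ≤ 10 ^ (m + 1) - 1 := by
    have : 0 < 10 ^ m := by positivity
    rw [pow_succ]; omega
  have h0 : 0 < 10 ^ m := by positivity
  unfold blockLen
  calc m * (10 ^ m - 1) ≤ m * (10 ^ (m + 1) - 1) := Nat.mul_le_mul_left _ (by omega)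
    _ < _ := Nat.mul_lt_mul_of_pos_right m.lt_succ_self (by omega)

lemma blockLen_strictMono : StrictMono blockLen := strictMono_nat_of_lt_succ blockLen_lt_succ

lemma blockLen_le (m : ℕ) : blockLen m ≤ m * 10 ^ m := Nat.mul_le_mul_left _ (Nat.sub_le _ _)

lemma repunit_lt (m : ℕ) : repunit (10 ^ m) (10 ^ m - 1) < 10 ^ blockLen m := by
  rw [← pow_blockLen]
  simpa [repunit] using
    sum_block_lt (X := 10 ^ m) (fun _ => 1) (10 ^ m - 1) (fun j hj => by omega)

lemma ascending_lt (m : ℕ) : ascending (10 ^ m) (10 ^ m - 1) < 10 ^ blockLen m := by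
  rw [← pow_blockLen]
  exact sum_block_lt (X := 10 ^ m) (fun k => k + 1) (10 ^ m - 1) (fun j hj => by omega)

lemma pow_le_sparseNum (e m : ℕ) :
    10 ^ (2 * blockLen m + blockLen (m - e)) ≤ sparseNum e m := by
  rw [sparseNum, universalNum]
  calc _ = 10 ^ blockLen m * (10 ^ blockLen m * 10 ^ blockLen (m - e)) := by ring
    _ ≤ _ := by
      refine Nat.mul_le_mul_left _ (le_trans (Nat.mul_le_mul_left _ ?_) (Nat.le_add_left _ _))
      exact Nat.le_add_left _ _

lemma sparseNum_lt (e m : ℕ) :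
    sparseNum e m < 10 ^ (2 * blockLen m + blockLen (m - e) + 1) := by
  have h1 := repunit_lt m
  have h2 : universalNum (m - e) + 1 ≤ 10 * 10 ^ blockLen (m - e) := by
    have := ascending_lt (m - e)
    rw [universalNum]; omega
  calc sparseNum e m
      < 10 ^ blockLen m * (10 ^ blockLen m * (universalNum (m - e) + 1)) := by
        rw [sparseNum]
        refine Nat.mul_lt_mul_of_pos_left ?_ (by positivity)
        rw [mul_add, mul_one]; omega
    _ ≤ 10 ^ blockLen m * (10 ^ blockLen m * (10 * 10 ^ blockLen (m - e))) := by gcongr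
    _ = _ := by ring

lemma sparseNum_strictMono (e : ℕ) : StrictMono (sparseNum e) := by
  refine strictMono_nat_of_lt_succ fun m => ?_
  refine (sparseNum_lt e m).trans_le (le_trans ?_ (pow_le_sparseNum e (m + 1)))
  have h1 := blockLen_lt_succ m
  have h2 := blockLen_strictMono.monotone (show m - e ≤ m + 1 - e by omega)
  exact Nat.pow_le_pow_right (by norm_num) (by omega)

lemma length_sparseNum (hb : 0 < 10) (e m : ℕ) :
    (digitsFin 10 hb (sparseNum e m)).length = 2 * blockLen m + blockLen (m - e) + 1 := by
  rw [length_digitsFin]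
  exact le_antisymm (digits_length_le (sparseNum_lt e m))
    (lt_length_digits_iff.mpr (pow_le_sparseNum e m))

lemma length_sparseNum_le (hb : 0 < 10) (e m : ℕ) :
    (digitsFin 10 hb (sparseNum e m)).length ≤ 4 * (m + 1) * 10 ^ m := by
  rw [length_sparseNum]
  have h1 := blockLen_le m
  have h2 := blockLen_strictMono.monotone (Nat.sub_le m e)
  have h3 : 0 < 10 ^ m := by positivity
  nlinarith

lemma le_slideN_sparseNum (hb : 0 < 10) {l : ℕ} (hl : 0 < l) (e m : ℕ) (w : Fin l → Fin 10) :
    (m - e - l) * (10 ^ (m - e - l) - 1) ≤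
      slideN (List.ofFn w) (digitsFin 10 hb (sparseNum e m)) := by
  refine le_slideN_of_ascending hb hl (T := 2 * blockLen m) (Z := 1)
    (low := 10 ^ blockLen m * repunit (10 ^ m) (10 ^ m - 1)) ?_ ?_ (pow_le_sparseNum e m) w
  · rw [two_mul, pow_add]
    exact Nat.mul_lt_mul_of_pos_left (repunit_lt m) (by positivity)
  · rw [sparseNum, universalNum, pow_blockLen]; ring

lemma wordVal_zero (l : ℕ) : wordVal (fun _ : Fin l => (0 : Fin 10)) = 0 := by simp [wordVal]

lemma le_slideN_zero_sparseNum (hb : 0 < 10) {l : ℕ} (hl : 0 < l) (e m : ℕ) :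
    2 * (10 ^ m - 1) * (m - l) ≤
      slideN (List.ofFn fun _ : Fin l => (0 : Fin 10)) (digitsFin 10 hb (sparseNum e m)) := by
  set J := 10 ^ m - 1 with hJ
  have hJ' : m * J = blockLen m := rfl
  have key := card_le_slideN_of_blocks hb (m := m) (J := J + J) (T := 0) (low := 0)
    (Z := universalNum (m - e)) (V := sparseNum e m) (c := fun k => if k < J then 0 else 1) hl
    (fun j hj => by split_ifs <;> omega) (by norm_num) ?_ ?_ (fun _ => 0)
    (Finset.range (J + J) ×ˢ Finset.Icc 1 (m - l)) ?_
  · simpa [two_mul] using key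
  · rw [Finset.sum_range_add, Finset.sum_eq_zero, sparseNum, pow_add, ← hJ, hJ,
      pow_blockLen, ← hJ]
    · simp only [add_lt_iff_neg_left, not_lt_zero, if_false, one_mul, pow_zero, zero_add, add_zero]
      rw [repunit, mul_add, Finset.mul_sum, mul_assoc]
      congr 1
      refine Finset.sum_congr rfl fun k _ => ?_
      rw [pow_add, hJ, pow_blockLen]
    · intro k hk
      rw [if_pos (Finset.mem_range.mp hk), zero_mul]
  · refine le_trans (Nat.pow_le_pow_right (by norm_num) ?_) (pow_le_sparseNum e m)
    rw [mul_add, hJ']; omega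
  · rintro ⟨j, i⟩ hq
    simp only [Finset.mem_product, Finset.mem_range, Finset.mem_Icc] at hq
    refine ⟨hq.1, by simp only; omega, ?_⟩
    have h10 : 1 < 10 ^ i := Nat.one_lt_pow (by omega) (by norm_num)
    rw [wordVal_zero, Nat.div_eq_of_lt, Nat.zero_mod]
    simp only
    split_ifs <;> omega

lemma powerSum_eq {d : ℕ} (hd : 2 ≤ d) (n : ℕ) : ∃ z, powerSum d n = n ^ 2 + n ^ 3 * z := by
  unfold powerSum
  split_ifs with h
  · exact ⟨0, by ring⟩
  · exact ⟨n ^ (d - 3), by rw [← pow_add]; congr 2; omega⟩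

lemma powerSum_sparseNum_eq {d : ℕ} (hd : 2 ≤ d) (e m : ℕ) :
    ∃ Z, powerSum d (sparseNum e m) = 10 ^ (2 * blockLen m) *
      (ascending (10 ^ m) (10 ^ m - 1) + 10 ^ blockLen m * Z) := by
  obtain ⟨z, hz⟩ := powerSum_eq hd (sparseNum e m)
  obtain ⟨Z, hZ⟩ := repunit_sq (10 ^ m) (10 ^ m - 1)
  rw [pow_blockLen] at hZ
  set R := repunit (10 ^ m) (10 ^ m - 1)
  set u := universalNum (m - e)
  set B := 10 ^ blockLen m
  refine ⟨Z + 2 * R * u + B * u ^ 2 + (R + B * u) ^ 3 * z, ?_⟩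
  have hs : sparseNum e m = B * (R + B * u) := rfl
  have hB : 10 ^ (2 * blockLen m) = B ^ 2 := by rw [mul_comm, pow_mul]
  rw [hz, hs, hB]
  calc _ = B ^ 2 * (R ^ 2 + B * (2 * R * u + B * u ^ 2 + (R + B * u) ^ 3 * z)) := by ring
    _ = _ := by rw [hZ]; ring

lemma pow_le_powerSum_sparseNum (d e m : ℕ) :
    10 ^ (4 * blockLen m) ≤ powerSum d (sparseNum e m) := by
  calc 10 ^ (4 * blockLen m) = (10 ^ (2 * blockLen m)) ^ 2 := by ring
    _ ≤ (sparseNum e m) ^ 2 := by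
      gcongr
      exact (Nat.pow_le_pow_right (by norm_num) (Nat.le_add_right _ _)).trans
        (pow_le_sparseNum e m)
    _ ≤ _ := Nat.le_add_right _ _

lemma le_slideN_powerSum (hb : 0 < 10) {d l : ℕ} (hd : 2 ≤ d) (hl : 0 < l) (e m : ℕ)
    (w : Fin l → Fin 10) : (m - l) * (10 ^ (m - l) - 1) ≤
      slideN (List.ofFn w) (digitsFin 10 hb (powerSum d (sparseNum e m))) := by
  obtain ⟨Z, hZ⟩ := powerSum_sparseNum_eq hd e m
  refine le_slideN_of_ascending hb hl (T := 2 * blockLen m) (Z := Z) (low := 0) (by positivity)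
    ?_ ?_ w
  · rw [hZ, pow_blockLen, add_zero]
  · refine le_trans (Nat.pow_le_pow_right (by norm_num) ?_) (pow_le_powerSum_sparseNum d e m)
    have : m * (10 ^ m - 1) = blockLen m := rfl
    omega

lemma le_slideN_zero_powerSum (hb : 0 < 10) {d l : ℕ} (hd : 2 ≤ d) (hl : 0 < l) (e m : ℕ) :
    2 * (10 ^ m - 1) * (m - l) ≤ slideN (List.ofFn fun _ : Fin l => (0 : Fin 10))
      (digitsFin 10 hb (powerSum d (sparseNum e m))) := by
  obtain ⟨Z, hZ⟩ := powerSum_sparseNum_eq hd e m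
  have hJ : m * (10 ^ m - 1) = blockLen m := rfl
  have key := card_le_slideN_of_blocks hb (m := m) (J := 2 * (10 ^ m - 1)) (T := 0) (low := 0)
    (Z := ascending (10 ^ m) (10 ^ m - 1) + 10 ^ blockLen m * Z)
    (V := powerSum d (sparseNum e m)) (c := fun _ => 0) hl
    (fun j hj => by positivity) (by norm_num) ?_ ?_ (fun _ => 0)
    (Finset.range (2 * (10 ^ m - 1)) ×ˢ Finset.range (m - l)) ?_
  · simpa using key
  · rw [hZ, ← pow_mul, mul_left_comm, hJ]; simp
  · refine le_trans (Nat.pow_le_pow_right (by norm_num) ?_) (pow_le_powerSum_sparseNum d e m)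
    rw [mul_left_comm, hJ]; omega
  · rintro ⟨j, i⟩ hq
    simp only [Finset.mem_product, Finset.mem_range] at hq
    refine ⟨hq.1, by simp only; omega, ?_⟩
    rw [wordVal_zero, Nat.zero_div, Nat.zero_mod]

lemma length_powerSum_le (hb : 0 < 10) {d : ℕ} (hd : 2 ≤ d) (e m : ℕ) :
    (digitsFin 10 hb (powerSum d (sparseNum e m))).length ≤ 4 * (d + 1) * (m + 1) * 10 ^ m := by
  set q := (digitsFin 10 hb (sparseNum e m)).length with hq
  have hq1 : q ≤ 4 * (m + 1) * 10 ^ m := length_sparseNum_le hb e m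
  have hq0 : 1 ≤ q := by rw [hq, length_sparseNum]; omega
  have hlt : sparseNum e m < 10 ^ q := by rw [hq, length_sparseNum]; exact sparseNum_lt e m
  have h2 : sparseNum e m ^ 2 < 10 ^ (d * q) := by
    calc sparseNum e m ^ 2 < (10 ^ q) ^ 2 := Nat.pow_lt_pow_left hlt two_ne_zero
      _ = 10 ^ (2 * q) := by rw [← pow_mul, mul_comm]
      _ ≤ _ := Nat.pow_le_pow_right (by norm_num) (Nat.mul_le_mul_right _ hd)
  have hd' : sparseNum e m ^ d < 10 ^ (d * q) := by
    calc sparseNum e m ^ d < (10 ^ q) ^ d := Nat.pow_lt_pow_left hlt (by omega)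
      _ = _ := by rw [← pow_mul, mul_comm]
  have hp : powerSum d (sparseNum e m) < 10 ^ (d * q + 1) := by
    rw [powerSum, pow_succ 10]
    split_ifs <;> omega
  rw [length_digitsFin]
  calc _ ≤ d * q + 1 := digits_length_le hp
    _ ≤ (d + 1) * q := by rw [add_mul, one_mul]; omega
    _ ≤ (d + 1) * (4 * (m + 1) * 10 ^ m) := Nat.mul_le_mul_left _ hq1
    _ = _ := by ring

end Construction

section Estimates

lemma blockLen_sub_le (e m : ℕ) : (blockLen (m - e) : ℝ) ≤ m * 10 ^ m / 10 ^ e := by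
  rw [le_div_iff₀ (by positivity)]
  rcases Nat.lt_or_ge m e with h | h
  · rw [Nat.sub_eq_zero_of_le h.le]
    simp only [blockLen, zero_mul, Nat.cast_zero]
    positivity
  · have : blockLen (m - e) * 10 ^ e ≤ m * 10 ^ m := by
      calc blockLen (m - e) * 10 ^ e ≤ (m - e) * 10 ^ (m - e) * 10 ^ e :=
            Nat.mul_le_mul_right _ (blockLen_le _)
        _ = (m - e) * 10 ^ m := by rw [mul_assoc, ← pow_add, Nat.sub_add_cancel h]
        _ ≤ _ := Nat.mul_le_mul_right _ (Nat.sub_le _ _)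
    exact_mod_cast this

lemma length_sparseNum_sub_le (hb : 0 < 10) {l : ℕ} (hl : 0 < l) (e m : ℕ) :
    ((digitsFin 10 hb (sparseNum e m)).length : ℝ) ≤
      slideN (List.ofFn fun _ : Fin l => (0 : Fin 10)) (digitsFin 10 hb (sparseNum e m)) +
        ((2 * l + 1) * 10 ^ m + m * 10 ^ m / 10 ^ e) := by
  have h1 := le_slideN_zero_sparseNum hb hl e m
  have h2 := blockLen_sub_le e m
  have h3 : 2 * blockLen m + 1 ≤ 2 * (10 ^ m - 1) * (m - l) + (2 * l + 1) * 10 ^ m := by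
    have h0 : 0 < 10 ^ m := by positivity
    have h4 : blockLen m ≤ (10 ^ m - 1) * (m - l) + l * 10 ^ m := by
      calc blockLen m = (10 ^ m - 1) * m := mul_comm _ _
        _ ≤ (10 ^ m - 1) * ((m - l) + l) := Nat.mul_le_mul_left _ (by omega)
        _ = (10 ^ m - 1) * (m - l) + l * (10 ^ m - 1) := by ring
        _ ≤ _ := by gcongr; omega
    linarith
  have h5 : ((2 * blockLen m + 1 : ℕ) : ℝ) ≤
      slideN (List.ofFn fun _ : Fin l => (0 : Fin 10)) (digitsFin 10 hb (sparseNum e m)) +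
        ((2 * l + 1) * 10 ^ m : ℕ) := by
    exact_mod_cast h3.trans (Nat.add_le_add_right h1 _)
  rw [length_sparseNum]
  push_cast at h5 ⊢
  linarith

lemma half_le_pow_sub_one {t : ℕ} (ht : 0 < t) : (10 : ℝ) ^ t / 2 ≤ ((10 ^ t - 1 : ℕ) : ℝ) := by
  have h1 : 10 ^ 1 ≤ 10 ^ t := Nat.pow_le_pow_right (by norm_num) ht
  have h2 : (10 : ℝ) ≤ 10 ^ t := by exact_mod_cast h1
  rw [Nat.cast_sub (by omega)]
  push_cast
  linarith

lemma cumLen_sparseNum_le (hb : 0 < 10) {l : ℕ} (hl : 0 < l) (e t : ℕ) :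
    (cumLen (fun k => digitsFin 10 hb (sparseNum e k)) (t + 1) : ℝ) ≤
      ((∑ k ∈ Finset.range (t + 1), slideN (List.ofFn fun _ : Fin l => (0 : Fin 10))
        (digitsFin 10 hb (sparseNum e k)) : ℕ) : ℝ) +
        2 * ((2 * l + 1) * 10 ^ t + t * 10 ^ t / 10 ^ e) := by
  induction t with
  | zero =>
    have h := length_sparseNum_sub_le hb hl e 0
    simp only [cumLen, Finset.sum_range_one, zero_add]
    have : (0 : ℝ) ≤ (2 * l + 1) * 10 ^ 0 := by positivity
    simp only [Nat.cast_zero, zero_mul, zero_div, add_zero] at h ⊢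
    linarith
  | succ t ih =>
    have h := length_sparseNum_sub_le hb hl e (t + 1)
    rw [cumLen, Finset.sum_range_succ, Nat.cast_add, Nat.cast_add]
    have h1 : 2 * ((2 * (l : ℝ) + 1) * 10 ^ t) ≤ (2 * l + 1) * 10 ^ (t + 1) := by
      have : (0 : ℝ) ≤ (2 * l + 1) * 10 ^ t := by positivity
      rw [pow_succ]; linarith
    have h2 : 2 * ((t : ℝ) * 10 ^ t / 10 ^ e) ≤ ((t + 1 : ℕ) : ℝ) * 10 ^ (t + 1) / 10 ^ e := by
      rw [← mul_div_assoc]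
      refine div_le_div_of_nonneg_right ?_ (by positivity)
      have h3 : (0 : ℝ) ≤ 10 ^ t := by positivity
      have h4 : (0 : ℝ) ≤ t * 10 ^ t := by positivity
      push_cast
      rw [pow_succ]
      linarith
    linarith

lemma eventually_sparse (hb : 0 < 10) {l : ℕ} (hl : 0 < l) (e : ℕ) : ∀ᶠ t in atTop,
    (1 - 3 / 10 ^ e) * (cumLen (fun k => digitsFin 10 hb (sparseNum e k)) (t + 1) : ℝ) ≤
      ((∑ k ∈ Finset.range (t + 1), slideN (List.ofFn fun _ : Fin l => (0 : Fin 10))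
        (digitsFin 10 hb (sparseNum e k)) : ℕ) : ℝ) := by
  filter_upwards [eventually_ge_atTop (2 * (2 * l + 1) * 10 ^ e)] with t ht
  have hp : 0 < 10 ^ e := by positivity
  have ht0 : 0 < t := lt_of_lt_of_le (by positivity) ht
  have h1 := cumLen_sparseNum_le hb hl e t
  have hlow : (t : ℝ) * 10 ^ t ≤
      (cumLen (fun k => digitsFin 10 hb (sparseNum e k)) (t + 1) : ℝ) := by
    have h2 : 2 * blockLen t ≤ cumLen (fun k => digitsFin 10 hb (sparseNum e k)) (t + 1) := by
      rw [cumLen, length_sparseNum]; omega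
    have h3 : ((2 * blockLen t : ℕ) : ℝ) ≤
      (cumLen (fun k => digitsFin 10 hb (sparseNum e k)) (t + 1) : ℝ) := by exact_mod_cast h2
    refine le_trans ?_ h3
    rw [blockLen, Nat.cast_mul, Nat.cast_mul, Nat.cast_ofNat]
    have := mul_le_mul_of_nonneg_left (half_le_pow_sub_one ht0) (Nat.cast_nonneg (α := ℝ) t)
    linarith
  have htR : 2 * (2 * (l : ℝ) + 1) ≤ t / 10 ^ e := by
    rw [le_div_iff₀ (by positivity)]; exact_mod_cast ht
  have h4 : 2 * ((2 * (l : ℝ) + 1) * 10 ^ t + t * 10 ^ t / 10 ^ e) ≤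
      3 / 10 ^ e * (t * 10 ^ t) := by
    have := mul_le_mul_of_nonneg_right htR (show (0 : ℝ) ≤ 10 ^ t by positivity)
    have e1 : 3 / 10 ^ e * ((t : ℝ) * 10 ^ t) = 3 * (t / 10 ^ e * 10 ^ t) := by ring
    have e2 : (t : ℝ) * 10 ^ t / 10 ^ e = t / 10 ^ e * 10 ^ t := by ring
    rw [e1, e2]
    linarith
  have h5 := mul_le_mul_of_nonneg_left hlow (show (0 : ℝ) ≤ 3 / 10 ^ e by positivity)
  linarith

lemma eventually_powerSum (hb : 0 < 10) {d l : ℕ} (hd : 2 ≤ d) (hl : 0 < l) (e : ℕ) :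
    ∀ᶠ t in atTop, (1 / (16 * (d + 1)) : ℝ) *
      (cumLen (fun k => digitsFin 10 hb (powerSum d (sparseNum e k))) (t + 1) : ℝ) ≤
      ((∑ k ∈ Finset.range (t + 1), slideN (List.ofFn fun _ : Fin l => (0 : Fin 10))
        (digitsFin 10 hb (powerSum d (sparseNum e k))) : ℕ) : ℝ) := by
  filter_upwards [eventually_ge_atTop (2 * l + 1)] with t ht
  have h1 := cumLen_le (L := fun k => digitsFin 10 hb (powerSum d (sparseNum e k)))
    (length_powerSum_le hb hd e) t
  have h1R : (cumLen (fun k => digitsFin 10 hb (powerSum d (sparseNum e k))) (t + 1) : ℝ) ≤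
    2 * (4 * (d + 1)) * (t + 1) * 10 ^ t := by exact_mod_cast h1
  have h2 : 2 * (10 ^ t - 1) * (t - l) ≤ ∑ k ∈ Finset.range (t + 1),
      slideN (List.ofFn fun _ : Fin l => (0 : Fin 10))
        (digitsFin 10 hb (powerSum d (sparseNum e k))) :=
    (le_slideN_zero_powerSum hb hd hl e t).trans
      (Finset.single_le_sum (f := fun k => slideN (List.ofFn fun _ : Fin l => (0 : Fin 10))
        (digitsFin 10 hb (powerSum d (sparseNum e k)))) (fun _ _ => Nat.zero_le _) (by simp))
  have h3 : ((t : ℝ) + 1) / 2 ≤ ((t - l : ℕ) : ℝ) := by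
    have : t + 1 ≤ 2 * (t - l) := by omega
    rw [div_le_iff₀ two_pos, mul_comm]
    exact_mod_cast this
  have h4 := half_le_pow_sub_one (show 0 < t by omega)
  calc _ ≤ (1 / (16 * (d + 1)) : ℝ) * (2 * (4 * (d + 1)) * (t + 1) * 10 ^ t) := by gcongr
    _ = 2 * (10 ^ t / 2) * ((t + 1) / 2) := by field_simp; norm_num
    _ ≤ 2 * ((10 ^ t - 1 : ℕ) : ℝ) * ((t - l : ℕ) : ℝ) := by gcongr
    _ ≤ _ := by exact_mod_cast h2

end Estimates

section Assembly

lemma nth_mem_range {a : ℕ → ℕ} (ha : StrictMono a) : Nat.nth (· ∈ Set.range a) = a := by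
  have hinf : (Set.ofPred (· ∈ Set.range a)).Infinite := Set.infinite_range_of_injective ha.injective
  refine ((Nat.nth_strictMono hinf).range_inj ha).mp ?_
  rw [Nat.range_nth_of_infinite hinf]
  rfl

open Polynomial in
/-- The rational polynomial with values `powerSum d n`. -/
noncomputable def powerSumPoly (d : ℕ) : ℚ[X] := X ^ 2 + if d = 2 then 0 else X ^ d

lemma natDegree_powerSumPoly {d : ℕ} (hd : 2 ≤ d) : (powerSumPoly d).natDegree = d := by
  unfold powerSumPoly
  split_ifs with h
  · simp [h]
  · rw [Polynomial.natDegree_add_eq_right_of_natDegree_lt] <;> simp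
    omega

lemma eval_powerSumPoly (d n : ℕ) : (powerSumPoly d).eval (n : ℚ) = (powerSum d n : ℕ) := by
  unfold powerSumPoly powerSum
  split_ifs <;> simp

lemma powerSum_pos (d e m : ℕ) : 0 < powerSum d (sparseNum e m) :=
  lt_of_lt_of_le (by positivity) (pow_le_powerSum_sparseNum d e m)

lemma CEseq_range (hb : 0 < 10) {a : ℕ → ℕ} (ha : StrictMono a) :
    CEseq 10 hb (Set.range a) = concatSeq ⟨0, hb⟩ (fun i => digitsFin 10 hb (a i)) := by
  rw [CEseq, nth_mem_range ha]

lemma CEseqF_range (hb : 0 < 10) {a : ℕ → ℕ} (ha : StrictMono a) (d : ℕ) :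
    CEseqF 10 hb (Set.range a)
        (fun n => (((powerSumPoly d).eval (n : ℚ) : ℚ) : ℝ)) =
      concatSeq ⟨0, hb⟩ (fun i => digitsFin 10 hb (powerSum d (a i))) := by
  rw [CEseqF, nth_mem_range ha]
  simp only [eval_powerSumPoly, Rat.cast_natCast, Nat.floor_natCast]

end Assembly

/-- For every integer `d ≥ 2` there exist an infinite set `A ⊆ ℕ`
and a polynomial `p ∈ ℚ[x]` of degree `d` such that
`0 < dim_FS(CE₁₀(A)) < dim_FS(CE₁₀(p(A))) < 1`. -/
theorem stmt11 (d : ℕ) (hd : 2 ≤ d) :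
    ∃ (A : Set ℕ) (p : Polynomial ℚ), A.Infinite ∧ p.natDegree = d ∧
      0 < dimFS (CEseq 10 (by omega) A) ∧
      dimFS (CEseq 10 (by omega) A) <
        dimFS (CEseqF 10 (by omega) A (fun n => ((p.eval (n : ℚ) : ℚ) : ℝ))) ∧
      dimFS (CEseqF 10 (by omega) A (fun n => ((p.eval (n : ℚ) : ℚ) : ℝ))) < 1 := by
  have hb : 0 < 10 := by omega
  set c : ℝ := (10 ^ (0 + 3) * (4 * (d + 1) : ℕ) : ℝ)⁻¹ with hc
  have hc0 : 0 < c := by positivity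
  obtain ⟨l, hl⟩ := exists_nat_one_div_lt (half_pos hc0)
  obtain ⟨e, he⟩ := exists_pow_lt_of_lt_one (show 0 < min (c / 6) (1 / 3) by positivity)
    (show (1 / 10 : ℝ) < 1 by norm_num)
  rw [lt_min_iff, one_div_pow, one_div] at he
  have ha := sparseNum_strictMono e
  have hLA : ∀ m, 0 < (digitsFin 10 hb (sparseNum e m)).length := fun m => by
    rw [length_sparseNum]; omega
  have hLP : ∀ m, 0 < (digitsFin 10 hb (powerSum d (sparseNum e m))).length := fun m => by
    rw [length_digitsFin]
    exact lt_length_digits_iff.mpr (by rw [pow_zero]; exact powerSum_pos d e m)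
  refine ⟨Set.range (sparseNum e), powerSumPoly d, Set.infinite_range_of_injective ha.injective,
    natDegree_powerSumPoly hd, ?_⟩
  rw [CEseq_range hb ha, CEseqF_range hb ha]
  refine ⟨?_, ?_, ?_⟩
  · refine lt_of_lt_of_le (by positivity) (dimFS_concatSeq_ge (e := e) (B := 4) (by norm_num) hLA
      (length_sparseNum_le hb e) (fun k w t hk _ => le_slideN_sparseNum hb hk e t w) _)
  · have hup := dimFS_concatSeq_le (l := l) (a := 1 - 3 / 10 ^ e)
      (by rw [div_eq_mul_inv]; linarith) hLA ⟨0, hb⟩ (fun _ => 0)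
      (eventually_sparse hb l.succ_pos e)
    have hlow : c ≤ dimFS (concatSeq ⟨0, hb⟩
        (fun i => digitsFin 10 hb (powerSum d (sparseNum e i)))) :=
      dimFS_concatSeq_ge (e := 0) (B := 4 * (d + 1)) (by positivity) hLP
        (length_powerSum_le hb hd e)
        (fun k w t hk _ => by simpa using le_slideN_powerSum hb hd hk e t w) _
    rw [div_eq_mul_inv 3] at hup
    linarith
  · have hup := dimFS_concatSeq_le (l := 16 * (d + 1)) (a := 1 / (16 * (d + 1))) (by positivity)
      hLP ⟨0, hb⟩ (fun _ => 0) (eventually_powerSum hb hd (Nat.succ_pos _) e)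
    have hlt : (1 : ℝ) / (((16 * (d + 1) : ℕ) : ℝ) + 1) < 1 / (16 * (d + 1)) := by
      push_cast
      exact one_div_lt_one_div_of_lt (by positivity) (by linarith)
    linarith
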